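/- Let r = X → Y be a totally-ordered sequential rule over a sequence database D, and let r' be a ToSR obtained from r by a left I-expansion or a left S-expansion with an item i. Then the three left-expansion upper bounds form a chain: LERSPEU(r') ≤ LERSU(r') ≤ LEPEU(r), where LERSU(r') = Σ_{s ∈ seq(r')} LEPEU(r, s). -/

import Mathlib

open scoped Classical

noncomputable section

namespace TotalSR

variable {I : Type*} [LinearOrder I]

/-- A sequence: a list of itemsets. -/
abbrev Seqc (I : Type*) := List (Finset I)

/-- The set of items occurring in a sequence. -/
def itemsOf (s : Seqc I) : Finset I := s.foldr (· ∪ ·) ∅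

/-- Well-formed sequence: nonempty, all itemsets nonempty, and each item
occurs at most once (itemsets pairwise disjoint). -/
def WFSeq (s : Seqc I) : Prop :=
  s ≠ [] ∧ (∀ e ∈ s, e.Nonempty) ∧ s.Pairwise fun a b => Disjoint a b

/-- `s₁` occurs in `s₂` (written s₁ ⊑ s₂): there exist strictly increasing
indices matching each itemset of `s₁` into a superset itemset of `s₂`. -/
def OccursIn (s₁ s₂ : Seqc I) : Prop :=
  ∃ t : List (Finset I), t.Sublist s₂ ∧ List.Forall₂ (· ⊆ ·) s₁ t

/-- The rule X → Y occurs in s: there is a split position 1 ≤ k < |s|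
with X occurring in the first k itemsets and Y in the remaining ones. -/
def RuleOccursIn (X Y s : Seqc I) : Prop :=
  ∃ k, 1 ≤ k ∧ k < s.length ∧ OccursIn X (s.take k) ∧ OccursIn Y (s.drop k)

/-- seq(r): the sequences of the database D in which the rule X → Y occurs. -/
def seqL (D : List (Seqc I)) (X Y : Seqc I) : List (Seqc I) :=
  D.filter fun s => decide (RuleOccursIn X Y s)

/-- ant(r): the sequences of the database D in which the antecedent X occurs. -/
def antL (D : List (Seqc I)) (X : Seqc I) : List (Seqc I) :=
  D.filter fun s => decide (OccursIn X s)

/-- conf(r) = |seq(r)| / |ant(r)|. -/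
def conf (D : List (Seqc I)) (X Y : Seqc I) : ℝ :=
  ((seqL D X Y).length : ℝ) / ((antL D X).length : ℝ)

variable (q : I → Seqc I → ℝ) (iu : I → ℝ)

/-- u(i, s) = q(i, s) · iu(i). -/
def itemUtil (j : I) (s : Seqc I) : ℝ := q j s * iu j

/-- u(r, s): the sum of u(i, s) over all items occurring in X or Y. -/
def ruleUtilIn (X Y s : Seqc I) : ℝ :=
  ∑ j ∈ itemsOf X ∪ itemsOf Y, itemUtil q iu j s

/-- u(r) = Σ_{s ∈ seq(r)} u(r, s). -/
def ruleUtil (D : List (Seqc I)) (X Y : Seqc I) : ℝ :=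
  ((seqL D X Y).map (ruleUtilIn q iu X Y)).sum

/-- I-extension of a sequence: insert item i into the last itemset. -/
def iExt (X : Seqc I) (i : I) : Seqc I := X.dropLast ++ [insert i (X.getLastD ∅)]

/-- S-extension of a sequence: append the singleton itemset {i}. -/
def sExt (X : Seqc I) (i : I) : Seqc I := X ++ [{i}]

/-- X' is obtained from the rule X → Y by a left I- or S-expansion with item i. -/
def IsLeftExp (X Y : Seqc I) (i : I) (X' : Seqc I) : Prop :=
  i ∉ itemsOf Y ∧
    ((X' = iExt X i ∧ ∀ a ∈ X.getLastD ∅, a < i) ∨ X' = sExt X i)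

/-- Y' is obtained from the rule X → Y by a right I- or S-expansion with item i. -/
def IsRightExp (X Y : Seqc I) (i : I) (Y' : Seqc I) : Prop :=
  i ∉ itemsOf X ∧
    ((Y' = iExt Y i ∧ ∀ a ∈ Y.getLastD ∅, a < i) ∨ Y' = sExt Y i)

/-- ULeft(r, s): sum of u(j, s) over items j of s such that some left
expansion of r with j occurs in s. -/
def ULeft (X Y s : Seqc I) : ℝ :=
  ∑ j ∈ (itemsOf s).filter
      (fun j => ∃ X', IsLeftExp X Y j X' ∧ RuleOccursIn X' Y s),
    itemUtil q iu j s

/-- LEPEU(r, s). -/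
def LEPEUs (X Y s : Seqc I) : ℝ :=
  if 0 < ULeft q iu X Y s then ruleUtilIn q iu X Y s + ULeft q iu X Y s else 0

/-- LEPEU(r) = Σ_{s ∈ seq(r)} LEPEU(r, s). -/
def LEPEU (D : List (Seqc I)) (X Y : Seqc I) : ℝ :=
  ((seqL D X Y).map (LEPEUs q iu X Y)).sum

/-- URight(r, s): sum of u(j, s) over items j of s such that some right
expansion of r with j occurs in s. -/
def URight (X Y s : Seqc I) : ℝ :=
  ∑ j ∈ (itemsOf s).filter
      (fun j => ∃ Y', IsRightExp X Y j Y' ∧ RuleOccursIn X Y' s),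
    itemUtil q iu j s

/-- REPEU(r, s). -/
def REPEUs (X Y s : Seqc I) : ℝ :=
  if 0 < URight q iu X Y s then ruleUtilIn q iu X Y s + URight q iu X Y s else 0

/-- REPEU(r) = Σ_{s ∈ seq(r)} REPEU(r, s). -/
def REPEU (D : List (Seqc I)) (X Y : Seqc I) : ℝ :=
  ((seqL D X Y).map (REPEUs q iu X Y)).sum

/-- j occurs strictly after i in s: in a strictly later itemset, or in the
same itemset and strictly greater in the item order. -/
def AfterIn (s : Seqc I) (i j : I) : Prop :=
  ∃ a b : Fin s.length, i ∈ s.get a ∧ j ∈ s.get b ∧ (a < b ∨ (a = b ∧ i < j))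

/-- UILeft(r, i, s): u(i, s) plus the sum of u(j, s) over items j of s
occurring strictly after i such that some left expansion of r with j occurs in s. -/
def UILeft (X Y : Seqc I) (i : I) (s : Seqc I) : ℝ :=
  itemUtil q iu i s +
    ∑ j ∈ (itemsOf s).filter
        (fun j => AfterIn s i j ∧ ∃ X', IsLeftExp X Y j X' ∧ RuleOccursIn X' Y s),
      itemUtil q iu j s

/-- LERSPEU(r') = Σ_{s ∈ seq(r')} (u(r, s) + UILeft(r, i, s)), where r' = X⋄i → Y. -/
def LERSPEU (D : List (Seqc I)) (X Y : Seqc I) (i : I) (X' : Seqc I) : ℝ :=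
  ((seqL D X' Y).map fun s => ruleUtilIn q iu X Y s + UILeft q iu X Y i s).sum

/-- UIRight(r, i, s): u(i, s) plus the sum of u(j, s) over items j of s
occurring strictly after i in s. -/
def UIRight (i : I) (s : Seqc I) : ℝ :=
  itemUtil q iu i s +
    ∑ j ∈ (itemsOf s).filter (fun j => AfterIn s i j), itemUtil q iu j s

/-- RERSPEU(r') = Σ_{s ∈ seq(r')} (u(r, s) + UIRight(r, i, s)), where r' = X → Y⋄i. -/
def RERSPEU (D : List (Seqc I)) (X Y : Seqc I) (i : I) (Y' : Seqc I) : ℝ :=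
  ((seqL D X Y').map fun s => ruleUtilIn q iu X Y s + UIRight q iu i s).sum

/-- The total utility of all items occurring in a sequence. -/
def totalUtil (s : Seqc I) : ℝ := ∑ j ∈ itemsOf s, itemUtil q iu j s

/-- SEU(i): sum, over the sequences of D in which item i occurs, of the
total utility of the sequence. -/
def SEUitem (D : List (Seqc I)) (i : I) : ℝ :=
  ((D.filter fun s => decide (i ∈ itemsOf s)).map (totalUtil q iu)).sum

/-- SEU(r): sum, over the sequences of D in which the rule r occurs, of the
total utility of the sequence. -/
def SEUrule (D : List (Seqc I)) (X Y : Seqc I) : ℝ :=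
  ((seqL D X Y).map (totalUtil q iu)).sum

/-- One expansion step on rules (as pairs (antecedent, consequent)):
either a left I- or S-expansion or a right I- or S-expansion with some item. -/
def ExpStep (p p' : Seqc I × Seqc I) : Prop :=
  (∃ i, IsLeftExp p.1 p.2 i p'.1 ∧ p'.2 = p.2) ∨
    (∃ i, IsRightExp p.1 p.2 i p'.2 ∧ p'.1 = p.1)

theorem mem_itemsOf {s : Seqc I} {j : I} : j ∈ itemsOf s ↔ ∃ e ∈ s, j ∈ e := by
  induction s with
  | nil => simp [itemsOf]
  | cons a s ih =>
    have h : itemsOf (a :: s) = a ∪ itemsOf s := rfl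
    rw [h, Finset.mem_union, ih]
    simp

theorem OccursIn.itemsOf_subset {s t : Seqc I} (h : OccursIn s t) :
    itemsOf s ⊆ itemsOf t := by
  obtain ⟨l, hl, hsl⟩ := h
  intro j hj
  obtain ⟨e, he, hje⟩ := mem_itemsOf.1 hj
  suffices ∃ e' ∈ l, j ∈ e' by
    obtain ⟨e', he', hj'⟩ := this
    exact mem_itemsOf.2 ⟨e', hl.subset he', hj'⟩
  clear hl hj
  induction hsl with
  | nil => simp at he
  | cons hab _ ih =>
    rcases List.mem_cons.1 he with rfl | he
    · exact ⟨_, List.mem_cons_self, hab hje⟩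
    · obtain ⟨e', he', hj'⟩ := ih he
      exact ⟨e', List.mem_cons_of_mem _ he', hj'⟩

theorem itemsOf_mono {s t : Seqc I} (h : s ⊆ t) : itemsOf s ⊆ itemsOf t := by
  intro j hj
  obtain ⟨e, he, hje⟩ := mem_itemsOf.1 hj
  exact mem_itemsOf.2 ⟨e, h he, hje⟩

theorem RuleOccursIn.itemsOf_left_subset {X Y s : Seqc I} (h : RuleOccursIn X Y s) :
    itemsOf X ⊆ itemsOf s := by
  obtain ⟨k, -, -, hX, -⟩ := h
  exact hX.itemsOf_subset.trans (itemsOf_mono (List.take_subset k s))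

theorem RuleOccursIn.itemsOf_right_subset {X Y s : Seqc I} (h : RuleOccursIn X Y s) :
    itemsOf Y ⊆ itemsOf s := by
  obtain ⟨k, -, -, -, hY⟩ := h
  exact hY.itemsOf_subset.trans (itemsOf_mono (List.drop_subset k s))

theorem occursIn_iff_sublistForall₂ {s t : Seqc I} :
    OccursIn s t ↔ List.SublistForall₂ (· ⊆ ·) s t := by
  simp only [OccursIn, List.sublistForall₂_iff, and_comm]

theorem OccursIn.trans {s t w : Seqc I} (hst : OccursIn s t) (htw : OccursIn t w) :
    OccursIn s w := by
  rw [occursIn_iff_sublistForall₂] at *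
  exact _root_.trans hst htw

theorem IsLeftExp.occursIn {X Y X' : Seqc I} {i : I} (h : IsLeftExp X Y i X') (hX : X ≠ []) :
    OccursIn X X' := by
  rcases h.2 with ⟨rfl, -⟩ | rfl
  · refine ⟨iExt X i, List.Sublist.refl _, ?_⟩
    have h : List.Forall₂ (· ⊆ ·) (X.dropLast ++ [X.getLast hX]) (iExt X i) := by
      rw [iExt, List.getLastD_eq_getLast?, List.getLast?_eq_some_getLast hX]
      exact List.rel_append (List.forall₂_refl _) (by simp)
    rwa [List.dropLast_append_getLast hX] at h
  · exact ⟨X, List.sublist_append_left _ _, List.forall₂_same.2 fun _ _ => subset_rfl⟩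

theorem IsLeftExp.mem_itemsOf {X Y X' : Seqc I} {i : I} (h : IsLeftExp X Y i X') :
    i ∈ itemsOf X' := by
  rcases h.2 with ⟨rfl, -⟩ | rfl <;> simp [TotalSR.mem_itemsOf, iExt, sExt]

theorem IsLeftExp.ruleOccursIn {X Y X' s : Seqc I} {i : I} (h : IsLeftExp X Y i X')
    (hX : X ≠ []) (hs : RuleOccursIn X' Y s) : RuleOccursIn X Y s := by
  obtain ⟨k, h1, hk, hX', hY⟩ := hs
  exact ⟨k, h1, hk, (h.occursIn hX).trans hX', hY⟩

theorem WFSeq.not_afterIn_self {s : Seqc I} (hs : WFSeq s) (i : I) : ¬ AfterIn s i i := by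
  rintro ⟨a, b, ha, hb, hab | ⟨-, h⟩⟩
  · exact Finset.disjoint_left.1 (List.pairwise_iff_get.1 hs.2.2 a b hab) ha hb
  · exact lt_irrefl i h

theorem LEPEUs_nonneg {q : I → Seqc I → ℝ} {iu : I → ℝ} {X Y s : Seqc I}
    (hu : ∀ j ∈ itemsOf s, 0 < itemUtil q iu j s) (hs : RuleOccursIn X Y s) :
    0 ≤ LEPEUs q iu X Y s := by
  unfold LEPEUs
  split_ifs with h
  · refine add_nonneg (Finset.sum_nonneg fun j hj => ?_) h.le
    exact (hu j (Finset.union_subset hs.itemsOf_left_subset hs.itemsOf_right_subset hj)).le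
  · exact le_rfl

theorem IsLeftExp.UILeft_le_ULeft {q : I → Seqc I → ℝ} {iu : I → ℝ} {X Y X' s : Seqc I} {i : I}
    (hu : ∀ j ∈ itemsOf s, 0 < itemUtil q iu j s) (hs : WFSeq s)
    (h : IsLeftExp X Y i X') (hr : RuleOccursIn X' Y s) :
    UILeft q iu X Y i s ≤ ULeft q iu X Y s := by
  unfold UILeft ULeft
  refine (Finset.sum_insert (f := fun j => itemUtil q iu j s)
    (by simp [hs.not_afterIn_self i])).symm.trans_le ?_
  refine Finset.sum_le_sum_of_subset_of_nonneg ?_ fun j hj _ =>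
    (hu j (Finset.mem_filter.1 hj).1).le
  intro j hj
  rcases Finset.mem_insert.1 hj with rfl | hj
  · exact Finset.mem_filter.2 ⟨hr.itemsOf_left_subset h.mem_itemsOf, X', h, hr⟩
  · obtain ⟨hj, -, hex⟩ := Finset.mem_filter.1 hj
    exact Finset.mem_filter.2 ⟨hj, hex⟩

theorem IsLeftExp.UILeft_pos {q : I → Seqc I → ℝ} {iu : I → ℝ} {X Y X' s : Seqc I} {i : I}
    (hu : ∀ j ∈ itemsOf s, 0 < itemUtil q iu j s)
    (h : IsLeftExp X Y i X') (hr : RuleOccursIn X' Y s) :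
    0 < UILeft q iu X Y i s :=
  add_pos_of_pos_of_nonneg (hu i (hr.itemsOf_left_subset h.mem_itemsOf))
    (Finset.sum_nonneg fun j hj => (hu j (Finset.mem_filter.1 hj).1).le)

/-- for a left expansion r' of r = X → Y with item i, the three
left-expansion upper bounds form a chain: LERSPEU(r') ≤ LERSU(r') ≤ LEPEU(r),
where LERSU(r') = Σ_{s ∈ seq(r')} LEPEU(r, s). -/
theorem left_upper_bounds_chain
    (hiu : ∀ j : I, 0 < iu j)
    (hq : ∀ (j : I) (s : Seqc I), j ∈ itemsOf s → 0 < q j s)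
    (D : List (Seqc I)) (hD : ∀ s ∈ D, WFSeq s)
    (X Y : Seqc I) (hX : WFSeq X) (hY : WFSeq Y)
    (hXY : Disjoint (itemsOf X) (itemsOf Y))
    (i : I) (X' : Seqc I) (hexp : IsLeftExp X Y i X')
    (hX' : WFSeq X') (hX'Y : Disjoint (itemsOf X') (itemsOf Y)) :
    LERSPEU q iu D X Y i X' ≤ ((seqL D X' Y).map (LEPEUs q iu X Y)).sum ∧
    ((seqL D X' Y).map (LEPEUs q iu X Y)).sum ≤ LEPEU q iu D X Y := by
  have hu (s : Seqc I) : ∀ j ∈ itemsOf s, 0 < itemUtil q iu j s := fun j hj =>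
    mul_pos (hq j s hj) (hiu j)
  constructor
  · refine List.sum_le_sum fun s hs => ?_
    obtain ⟨hsD, hr⟩ := List.mem_filter.1 hs
    have hr : RuleOccursIn X' Y s := of_decide_eq_true hr
    have hle := hexp.UILeft_le_ULeft (hu s) (hD s hsD) hr
    rw [LEPEUs, if_pos ((hexp.UILeft_pos (hu s) hr).trans_le hle)]
    exact add_le_add_right hle _
  · refine List.Sublist.sum_le_sum (List.Sublist.map _ ?_) fun x hx => ?_
    · refine List.monotone_filter_right D fun s hs => ?_
      exact decide_eq_true (hexp.ruleOccursIn hX.1 (of_decide_eq_true hs))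
    · obtain ⟨s, hs, rfl⟩ := List.mem_map.1 hx
      exact LEPEUs_nonneg (hu s) (of_decide_eq_true (List.mem_filter.1 hs).2)

end TotalSR
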